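/- Let $z$ be the center of gravity (centroid) of a convex body $K \subseteq \mathbb{R}^d$ in isotropic position. Then for any halfspace $H$ whose bounding hyperplane is within Euclidean distance $t$ of $z$, we have $\operatorname{vol}(K \cap H) \ge (1/e - t)\operatorname{vol}(K)$. -/

import Mathlib

open MeasureTheory
open scoped RealInnerProductSpace

section Auxiliary

open Set ENNReal

/-- One-dimensional Brunn–Minkowski inequality for compact sets. -/
lemma volume_add_le_of_isCompact {A B C : Set ℝ} (hA : IsCompact A) (hB : IsCompact B)
    (hA0 : A.Nonempty) (hB0 : B.Nonempty) {l m : ℝ} (hl : 0 < l) (hm : 0 < m)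
    (h : ∀ x ∈ A, ∀ y ∈ B, l * x + m * y ∈ C) :
    ENNReal.ofReal l * volume A + ENNReal.ofReal m * volume B ≤ volume C := by
  obtain ⟨a, ha, ha'⟩ := hA.exists_isGreatest hA0
  obtain ⟨b, hb, hb'⟩ := hB.exists_isLeast hB0
  have e1 : volume ((fun x => l * x + m * b) '' A) = ENNReal.ofReal l * volume A := by
    have : (fun x => l * x + m * b) '' A = (fun x => x + m * b) '' ((fun x => l • x) '' A) := by
      rw [image_image]; rfl
    rw [this, image_add_right, measure_preimage_add_right, image_smul, Measure.addHaar_smul]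
    simp [abs_of_pos hl]
  have e2 : volume ((fun y => l * a + m * y) '' B) = ENNReal.ofReal m * volume B := by
    have : (fun y => l * a + m * y) '' B = (fun x => l * a + x) '' ((fun x => m • x) '' B) := by
      rw [image_image]; rfl
    rw [this, image_add_left, measure_preimage_add, image_smul, Measure.addHaar_smul]
    simp [abs_of_pos hm]
  rw [← e1, ← e2, ← measure_union₀]
  · apply measure_mono
    rintro _ (⟨x, hx, rfl⟩ | ⟨y, hy, rfl⟩)
    · exact h x hx b hb
    · exact h a ha y hy
  · exact (hB.image (by fun_prop)).measurableSet.nullMeasurableSet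
  · refine measure_mono_null (t := {l * a + m * b}) ?_ (by simp)
    rintro _ ⟨⟨x, hx, rfl⟩, ⟨y, hy, hxy⟩⟩
    have h1 := mul_le_mul_of_nonneg_left (ha' hx) hl.le
    have h2 := mul_le_mul_of_nonneg_left (hb' hy) hm.le
    simp only at hxy
    simp only [mem_singleton_iff]
    linarith

/-- One-dimensional Brunn–Minkowski inequality for measurable sets. -/
lemma volume_add_le {A B C : Set ℝ} (hA : MeasurableSet A) (hB : MeasurableSet B)
    (hA0 : A.Nonempty) (hB0 : B.Nonempty) {l m : ℝ} (hl : 0 < l) (hm : 0 < m)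
    (h : ∀ x ∈ A, ∀ y ∈ B, l * x + m * y ∈ C) :
    ENNReal.ofReal l * volume A + ENNReal.ofReal m * volume B ≤ volume C := by
  obtain ⟨a, ha⟩ := hA0
  obtain ⟨b, hb⟩ := hB0
  rw [hA.measure_eq_iSup_isCompact, hB.measure_eq_iSup_isCompact]
  simp only [ENNReal.mul_iSup, iSup_and']
  refine ENNReal.biSup_add_biSup_le' (p := fun K => K ⊆ A ∧ IsCompact K)
    (q := fun K => K ⊆ B ∧ IsCompact K)
    ⟨∅, by simp⟩ ⟨∅, by simp⟩ ?_
  rintro A' ⟨hAA, hAc⟩ B' ⟨hBB, hBc⟩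
  refine le_trans ?_ (volume_add_le_of_isCompact (hAc.insert a) (hBc.insert b)
    (insert_nonempty _ _) (insert_nonempty _ _) hl hm (C := C) ?_)
  · gcongr <;> exact subset_insert _ _
  · intro x hx y hy
    exact h x (insert_subset ha hAA hx) y (insert_subset hb hBB hy)

/-- Layer-cake formula for a function with values in `[0, 1]`. -/
lemma lintegral_eq_lintegral_volume_Ioo {u : ℝ → ℝ≥0∞} (hu : Measurable u) (h1 : ∀ x, u x ≤ 1) :
    ∫⁻ x, u x = ∫⁻ s in Ioo (0 : ℝ) 1, volume {x | ENNReal.ofReal s < u x} := by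
  have e : ∀ x, u x = ENNReal.ofReal (u x).toReal := fun x =>
    (ENNReal.ofReal_toReal ((h1 x).trans_lt one_lt_top).ne).symm
  calc ∫⁻ x, u x = ∫⁻ x, ENNReal.ofReal (u x).toReal := lintegral_congr e
    _ = ∫⁻ s in Ioi (0 : ℝ), volume {x | s < (u x).toReal} :=
      lintegral_eq_lintegral_meas_lt _ (.of_forall fun _ => toReal_nonneg) hu.ennreal_toReal.aemeasurable
    _ = ∫⁻ s in Ioi (0 : ℝ), (Iio (1 : ℝ)).indicator
          (fun s => volume {x | ENNReal.ofReal s < u x}) s := by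
      refine setLIntegral_congr_fun measurableSet_Ioi fun s hs => ?_
      by_cases h : s < 1
      · simp only [mem_Iio, h, indicator_of_mem]
        congr 1; ext x
        simp only [mem_ofPred_eq]
        rw [ENNReal.ofReal_lt_iff_lt_toReal (le_of_lt hs) ((h1 x).trans_lt one_lt_top).ne]
      · simp only [mem_Iio, h, not_false_eq_true, indicator_of_notMem]
        convert measure_empty (μ := volume)
        ext x
        simp only [mem_ofPred_eq, mem_empty_iff_false, iff_false, not_lt]
        have := ENNReal.toReal_mono one_ne_top (h1 x)
        simp at this
        linarith
    _ = _ := by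
      rw [setLIntegral_indicator measurableSet_Iio]
      congr 2
      ext x; simp [and_comm]

lemma lintegral_add_le_of_iSup_eq_one {u v w : ℝ → ℝ≥0∞} (hu : Measurable u) (hv : Measurable v)
    (hw : Measurable w) (hu1 : ⨆ x, u x = 1) (hv1 : ⨆ x, v x = 1)
    {l m : ℝ} (hl : 0 < l) (hm : 0 < m) (hlm : l + m = 1)
    (h : ∀ x y, u x ^ l * v y ^ m ≤ w (l * x + m * y)) :
    ENNReal.ofReal l * (∫⁻ x, u x) + ENNReal.ofReal m * (∫⁻ x, v x) ≤ ∫⁻ x, w x := by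
  have hu' : ∀ x, u x ≤ 1 := fun x => hu1 ▸ le_iSup u x
  have hv' : ∀ x, v x ≤ 1 := fun x => hv1 ▸ le_iSup v x
  refine le_trans ?_ (lintegral_mono (fun x => min_le_left (w x) 1))
  rw [lintegral_eq_lintegral_volume_Ioo hu hu', lintegral_eq_lintegral_volume_Ioo hv hv',
    lintegral_eq_lintegral_volume_Ioo (hw.min measurable_const) (fun x => min_le_right _ _)]
  rw [← lintegral_const_mul' _ _ ofReal_ne_top, ← lintegral_const_mul' _ _ ofReal_ne_top]
  refine (le_lintegral_add _ _).trans (setLIntegral_mono' measurableSet_Ioo fun s hs => ?_)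
  have hs1 : ENNReal.ofReal s < 1 := by simpa using hs.2
  have key : ∀ p q : ℝ≥0∞, ENNReal.ofReal s < p → ENNReal.ofReal s < q →
      ENNReal.ofReal s < p ^ l * q ^ m := by
    intro p q hp hq
    have hs0 : ENNReal.ofReal s ≠ 0 := by simpa using hs.1
    calc ENNReal.ofReal s = ENNReal.ofReal s ^ l * ENNReal.ofReal s ^ m := by
          rw [← ENNReal.rpow_add _ _ hs0 ofReal_ne_top, hlm, ENNReal.rpow_one]
      _ < p ^ l * q ^ m := ENNReal.mul_lt_mul (ENNReal.rpow_lt_rpow hp hl)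
          (ENNReal.rpow_lt_rpow hq hm)
  refine volume_add_le (measurableSet_lt measurable_const hu)
    (measurableSet_lt measurable_const hv) ?_ ?_ hl hm ?_
  · exact lt_iSup_iff.1 (hu1 ▸ hs1)
  · exact lt_iSup_iff.1 (hv1 ▸ hs1)
  · intro x hx y hy
    exact lt_min ((key _ _ hx hy).trans_le (h x y)) hs1

lemma ENNReal.geom_mean_le_arith_mean2 {l m : ℝ} (hl : 0 < l) (hm : 0 < m) (hlm : l + m = 1)
    (p q : ℝ≥0∞) : p ^ l * q ^ m ≤ ENNReal.ofReal l * p + ENNReal.ofReal m * q := by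
  have hl' : ENNReal.ofReal l ≠ 0 := by simpa using hl
  have hm' : ENNReal.ofReal m ≠ 0 := by simpa using hm
  rcases eq_or_ne p ∞ with rfl | hp
  · simp [ENNReal.mul_top hl']
  rcases eq_or_ne q ∞ with rfl | hq
  · simp [ENNReal.mul_top hm']
  lift p to NNReal using hp
  lift q to NNReal using hq
  rw [← ENNReal.coe_rpow_of_nonneg _ hl.le, ← ENNReal.coe_rpow_of_nonneg _ hm.le]
  have := NNReal.geom_mean_le_arith_mean2_weighted l.toNNReal m.toNNReal p q
    (by rw [← Real.toNNReal_add hl.le hm.le, hlm, Real.toNNReal_one])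
  rw [Real.coe_toNNReal _ hl.le, Real.coe_toNNReal _ hm.le] at this
  simp only [ENNReal.ofReal]
  exact_mod_cast this

/-- The Prékopa–Leindler inequality on the line, for bounded functions. -/
lemma prekopa_leindler_real_of_bounded {f g h : ℝ → ℝ≥0∞} (hf : Measurable f) (hg : Measurable g)
    (hh : Measurable h) (hf1 : ⨆ x, f x ≠ ∞) (hg1 : ⨆ x, g x ≠ ∞)
    {l m : ℝ} (hl : 0 < l) (hm : 0 < m) (hlm : l + m = 1)
    (H : ∀ x y, f x ^ l * g y ^ m ≤ h (l * x + m * y)) :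
    (∫⁻ x, f x) ^ l * (∫⁻ x, g x) ^ m ≤ ∫⁻ x, h x := by
  set M := ⨆ x, f x with hM
  set N := ⨆ x, g x with hN
  rcases eq_or_ne M 0 with hM0 | hM0
  · have : f = 0 := by
      ext x; exact le_antisymm ((le_iSup f x).trans_eq hM0) bot_le
    simp [this, hl]
  rcases eq_or_ne N 0 with hN0 | hN0
  · have : g = 0 := by
      ext x; exact le_antisymm ((le_iSup g x).trans_eq hN0) bot_le
    simp [this, hm]
  set c : ℝ≥0∞ := M⁻¹ ^ l * N⁻¹ ^ m with hc
  have hMi : M⁻¹ ≠ ∞ := ENNReal.inv_ne_top.2 hM0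
  have hNi : N⁻¹ ≠ ∞ := ENNReal.inv_ne_top.2 hN0
  have hMz : M⁻¹ ≠ 0 := ENNReal.inv_ne_zero.2 hf1
  have hNz : N⁻¹ ≠ 0 := ENNReal.inv_ne_zero.2 hg1
  have hct : c ≠ ∞ := ENNReal.mul_ne_top (ENNReal.rpow_ne_top_of_nonneg hl.le hMi)
    (ENNReal.rpow_ne_top_of_nonneg hm.le hNi)
  have hc0 : c ≠ 0 := mul_ne_zero (ENNReal.rpow_pos (pos_iff_ne_zero.2 hMz) hMi).ne'
    (ENNReal.rpow_pos (pos_iff_ne_zero.2 hNz) hNi).ne'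
  have hmul : ∀ p q : ℝ≥0∞, (M⁻¹ * p) ^ l * (N⁻¹ * q) ^ m = c * (p ^ l * q ^ m) := by
    intro p q
    rw [ENNReal.mul_rpow_of_nonneg _ _ hl.le, ENNReal.mul_rpow_of_nonneg _ _ hm.le, hc]
    ring
  have key := lintegral_add_le_of_iSup_eq_one (u := fun x => M⁻¹ * f x) (v := fun x => N⁻¹ * g x)
    (w := fun x => c * h x) (hf.const_mul _) (hg.const_mul _) (hh.const_mul _)
    (by rw [← ENNReal.mul_iSup, ← hM, ENNReal.inv_mul_cancel hM0 hf1])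
    (by rw [← ENNReal.mul_iSup, ← hN, ENNReal.inv_mul_cancel hN0 hg1]) hl hm hlm
    (fun x y => by
      simp only [hmul]
      exact mul_le_mul_right (H x y) c)
  rw [lintegral_const_mul _ hf, lintegral_const_mul _ hg, lintegral_const_mul _ hh] at key
  have := (ENNReal.geom_mean_le_arith_mean2 hl hm hlm _ _).trans key
  rw [hmul] at this
  exact (ENNReal.mul_le_mul_iff_right hc0 hct).1 this

/-- The Prékopa–Leindler inequality on the line. -/
lemma prekopa_leindler_real {f g h : ℝ → ℝ≥0∞} (hf : Measurable f) (hg : Measurable g)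
    (hh : Measurable h) {l m : ℝ} (hl : 0 < l) (hm : 0 < m) (hlm : l + m = 1)
    (H : ∀ x y, f x ^ l * g y ^ m ≤ h (l * x + m * y)) :
    (∫⁻ x, f x) ^ l * (∫⁻ x, g x) ^ m ≤ ∫⁻ x, h x := by
  have trunc : ∀ k : ℝ → ℝ≥0∞, Measurable k →
      Filter.Tendsto (fun n : ℕ => ∫⁻ x, min (k x) n) Filter.atTop (nhds (∫⁻ x, k x)) := by
    intro k hk
    refine lintegral_tendsto_of_tendsto_of_monotone (fun n => (hk.min measurable_const).aemeasurable)
      (.of_forall fun x i j hij => min_le_min_left _ (by exact_mod_cast hij)) (.of_forall fun x => ?_)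
    have := (tendsto_const_nhds (x := k x)).min ENNReal.tendsto_nat_nhds_top
    simpa using this
  have T1 := ((ENNReal.continuous_rpow_const (y := l)).tendsto _).comp (trunc f hf)
  have T2 := ((ENNReal.continuous_rpow_const (y := m)).tendsto _).comp (trunc g hg)
  by_cases hz : (∫⁻ x, f x) = 0
  · simp [hz, hl]
  by_cases hz' : (∫⁻ x, g x) = 0
  · simp [hz', hm]
  refine le_of_tendsto (ENNReal.Tendsto.mul T1 (Or.inl ?_) T2 (Or.inl ?_)) (.of_forall fun n => ?_)
  · simp [hz, hl, ENNReal.rpow_eq_zero_iff, hl.not_gt]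
  · simp [hz', hm, ENNReal.rpow_eq_zero_iff, hm.not_gt]
  refine prekopa_leindler_real_of_bounded (hf.min measurable_const) (hg.min measurable_const) hh
    ?_ ?_ hl hm hlm fun x y => ?_
  · exact ((iSup_le fun x => min_le_right _ _).trans_lt (natCast_lt_top n)).ne
  · exact ((iSup_le fun x => min_le_right _ _).trans_lt (natCast_lt_top n)).ne
  · exact (mul_le_mul' (ENNReal.rpow_le_rpow (min_le_left _ _) hl.le)
      (ENNReal.rpow_le_rpow (min_le_left _ _) hm.le)).trans (H x y)

/-- The Prékopa–Leindler inequality on `ℝⁿ`. -/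
lemma prekopa_leindler_pi {l m : ℝ} (hl : 0 < l) (hm : 0 < m) (hlm : l + m = 1) (n : ℕ) :
    ∀ {f g h : (Fin n → ℝ) → ℝ≥0∞}, Measurable f → Measurable g → Measurable h →
    (∀ x y, f x ^ l * g y ^ m ≤ h (l • x + m • y)) →
    (∫⁻ x, f x) ^ l * (∫⁻ x, g x) ^ m ≤ ∫⁻ x, h x := by
  induction n with
  | zero =>
    intro f g h hf hg hh H
    simp only [Measure.volume_pi_eq_dirac (0 : Fin 0 → ℝ), lintegral_dirac]
    simpa using H 0 0
  | succ n ih =>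
    intro f g h hf hg hh H
    have e := (volume_preserving_piFinSuccAbove (fun _ : Fin (n + 1) => ℝ) 0).symm
    have e' : ∀ p, (MeasurableEquiv.piFinSuccAbove (fun _ : Fin (n + 1) => ℝ) 0).symm p =
        Fin.cons p.1 p.2 := fun p => by
      simp [MeasurableEquiv.piFinSuccAbove, Fin.consEquiv]
    have E : ∀ k : (Fin (n + 1) → ℝ) → ℝ≥0∞, Measurable k →
        ∫⁻ x, k x = ∫⁻ s : ℝ, ∫⁻ x : Fin n → ℝ, k (Fin.cons s x) := by
      intro k hk
      rw [← e.lintegral_comp hk, Measure.volume_eq_prod, lintegral_prod]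
      · simp only [e']
      · exact (hk.comp e.measurable).aemeasurable
    have M2 : ∀ k : (Fin (n + 1) → ℝ) → ℝ≥0∞, Measurable k →
        Measurable fun p : ℝ × (Fin n → ℝ) => k (Fin.cons p.1 p.2) :=
      fun k hk => by simpa only [Function.comp_def, e'] using hk.comp e.measurable
    rw [E f hf, E g hg, E h hh]
    refine prekopa_leindler_real (M2 f hf).lintegral_prod_right' (M2 g hg).lintegral_prod_right'
      (M2 h hh).lintegral_prod_right' hl hm hlm fun s r => ?_
    refine ih ((M2 f hf).comp measurable_prodMk_left) ((M2 g hg).comp measurable_prodMk_left)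
      ((M2 h hh).comp measurable_prodMk_left) fun x y => ?_
    refine (H _ _).trans_eq (congrArg h ?_)
    ext i
    refine Fin.cases ?_ (fun j => ?_) i <;> simp

/-- The multiplicative Brunn–Minkowski inequality. -/
lemma volume_rpow_mul_volume_rpow_le {d : ℕ} {l m : ℝ} (hl : 0 < l) (hm : 0 < m) (hlm : l + m = 1)
    {A B C : Set (EuclideanSpace ℝ (Fin d))} (hA : MeasurableSet A) (hB : MeasurableSet B)
    (hC : MeasurableSet C) (h : ∀ x ∈ A, ∀ y ∈ B, l • x + m • y ∈ C) :
    volume A ^ l * volume B ^ m ≤ volume C := by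
  have e := PiLp.volume_preserving_toLp (Fin d)
  rw [← e.measure_preimage hA.nullMeasurableSet, ← e.measure_preimage hB.nullMeasurableSet,
    ← e.measure_preimage hC.nullMeasurableSet]
  have hA' := e.measurable hA
  have hB' := e.measurable hB
  have hC' := e.measurable hC
  rw [← lintegral_indicator_one hA', ← lintegral_indicator_one hB', ← lintegral_indicator_one hC']
  refine prekopa_leindler_pi hl hm hlm d (measurable_one.indicator hA')
    (measurable_one.indicator hB') (measurable_one.indicator hC') fun x y => ?_
  by_cases hx : WithLp.toLp 2 x ∈ A
  · by_cases hy : WithLp.toLp 2 y ∈ B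
    · have := h _ hx _ hy
      have : l • x + m • y ∈ WithLp.toLp 2 ⁻¹' C := by simpa using this
      simp [indicator_of_mem this, indicator_of_mem (show x ∈ WithLp.toLp 2 ⁻¹' A from hx),
        indicator_of_mem (show y ∈ WithLp.toLp 2 ⁻¹' B from hy)]
    · rw [indicator_of_notMem (show y ∉ WithLp.toLp 2 ⁻¹' B from hy)]
      simp [hm]
  · rw [indicator_of_notMem (show x ∉ WithLp.toLp 2 ⁻¹' A from hx)]
    simp [hl]

/-- The upper tail function `x ↦ ν [x, ∞)` is log-concave. -/
def TailLogConcave (ν : Measure ℝ) : Prop :=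
  ∀ ⦃l m : ℝ⦄, 0 < l → 0 < m → l + m = 1 → ∀ x y : ℝ,
    ν (Ici x) ^ l * ν (Ici y) ^ m ≤ ν (Ici (l * x + m * y))

lemma TailLogConcave.mul_le {ν : Measure ℝ} (h : TailLogConcave ν) {s r : ℝ} (hs : 0 ≤ s)
    (hr : 0 ≤ r) : ν (Ici (s + r)) * ν (Ici 0) ≤ ν (Ici s) * ν (Ici r) := by
  rcases hs.eq_or_lt with rfl | hs
  · rw [zero_add, mul_comm]
  rcases hr.eq_or_lt with rfl | hr
  · rw [add_zero]
  have hsr : 0 < s + r := by positivity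
  have e1 : s / (s + r) + r / (s + r) = 1 := by field_simp
  have h1 := h (div_pos hs hsr) (div_pos hr hsr) e1 (s + r) 0
  have h2 := h (div_pos hs hsr) (div_pos hr hsr) e1 0 (s + r)
  rw [mul_zero, add_zero, div_mul_cancel₀ _ hsr.ne'] at h1
  rw [mul_zero, zero_add, div_mul_cancel₀ _ hsr.ne'] at h2
  refine le_trans (le_of_eq ?_) (mul_le_mul' h1 h2)
  have split : ∀ a : ℝ≥0∞, a = a ^ (s / (s + r)) * a ^ (r / (s + r)) := fun a => by
    rw [← ENNReal.rpow_add_of_nonneg _ _ (by positivity) (by positivity), e1, ENNReal.rpow_one]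
  conv_lhs => rw [split (ν (Ici (s + r))), split (ν (Ici 0))]
  ring

lemma lintegral_ofReal_sub_eq (ν : Measure ℝ) (s : ℝ) :
    ∫⁻ x, ENNReal.ofReal (x - s) ∂ν = ∫⁻ r in Ioi (0 : ℝ), ν (Ici (s + r)) := by
  have : ∀ x, ENNReal.ofReal (x - s) = ENNReal.ofReal (max (x - s) 0) := fun x => by simp
  simp only [this]
  rw [lintegral_eq_lintegral_meas_le ν (f := fun x => max (x - s) 0) (.of_forall fun x => le_max_right _ _)
    (by fun_prop)]
  refine setLIntegral_congr_fun measurableSet_Ioi fun r hr => ?_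
  congr 1
  ext x
  simp only [mem_ofPred_eq, mem_Ici, le_max_iff, (show ¬ r ≤ 0 from not_le.2 hr), or_false]
  constructor <;> intro h <;> linarith

lemma measurable_measure_Ici_add (ν : Measure ℝ) (s : ℝ) : Measurable fun r => ν (Ici (s + r)) :=
  Antitone.measurable fun _ _ h => measure_mono (Ici_subset_Ici.2 (by linarith))

lemma TailLogConcave.lintegral_ofReal_sub_mul_le {ν : Measure ℝ} (h : TailLogConcave ν) {s : ℝ}
    (hs : 0 ≤ s) :
    (∫⁻ x, ENNReal.ofReal (x - s) ∂ν) * ν (Ici 0) ≤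
      ν (Ici s) * ∫⁻ x, ENNReal.ofReal x ∂ν := by
  have e := lintegral_ofReal_sub_eq ν 0
  simp only [sub_zero, zero_add] at e
  rw [lintegral_ofReal_sub_eq, e, ← lintegral_mul_const _ (measurable_measure_Ici_add ν s),
    ← lintegral_const_mul _ (by simpa using measurable_measure_Ici_add ν 0)]
  exact setLIntegral_mono' measurableSet_Ioi fun r hr => h.mul_le hs (le_of_lt hr)

lemma ofReal_sq_le_lintegral (x : ℝ) :
    ENNReal.ofReal x ^ 2 ≤ 2 * ∫⁻ s in Ioi (0 : ℝ), ENNReal.ofReal (x - s) := by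
  rcases le_or_gt x 0 with hx | hx
  · simp [ENNReal.ofReal_of_nonpos hx]
  have h1 : ENNReal.ofReal (x ^ 2 / 2) = ∫⁻ s in Ioc 0 x, ENNReal.ofReal (x - s) := by
    rw [← ofReal_integral_eq_lintegral_ofReal]
    · rw [← intervalIntegral.integral_of_le hx.le]
      congr 1
      rw [intervalIntegral.integral_sub (by simp) (by simp)]
      simp
      ring
    · exact (Continuous.integrableOn_Icc (by fun_prop)).mono_set Ioc_subset_Icc_self
    · exact (ae_restrict_mem measurableSet_Ioc).mono fun s hs => sub_nonneg.2 hs.2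
  calc ENNReal.ofReal x ^ 2 = 2 * ENNReal.ofReal (x ^ 2 / 2) := by
        rw [← ENNReal.ofReal_pow hx.le, ← ENNReal.ofReal_ofNat 2,
          ← ENNReal.ofReal_mul (by norm_num)]
        congr 1; ring
    _ ≤ _ := by
        rw [h1]
        gcongr
        exact Ioc_subset_Ioi_self

lemma TailLogConcave.lintegral_sq_mul_le {ν : Measure ℝ} [SFinite ν] (h : TailLogConcave ν) :
    (∫⁻ x, ENNReal.ofReal x ^ 2 ∂ν) * ν (Ici 0) ≤ 2 * (∫⁻ x, ENNReal.ofReal x ∂ν) ^ 2 := by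
  have hm : Measurable fun p : ℝ × ℝ => ENNReal.ofReal (p.1 - p.2) := by fun_prop
  have e := lintegral_ofReal_sub_eq ν 0
  simp only [sub_zero, zero_add] at e
  calc (∫⁻ x, ENNReal.ofReal x ^ 2 ∂ν) * ν (Ici 0)
      ≤ (∫⁻ x, 2 * (∫⁻ s in Ioi (0 : ℝ), ENNReal.ofReal (x - s)) ∂ν) * ν (Ici 0) := by
        gcongr; exact ofReal_sq_le_lintegral _
    _ = 2 * ∫⁻ s in Ioi (0 : ℝ), (∫⁻ x, ENNReal.ofReal (x - s) ∂ν) * ν (Ici 0) := by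
        rw [lintegral_const_mul _ hm.lintegral_prod_right',
          lintegral_mul_const _ hm.lintegral_prod_left', lintegral_lintegral_swap hm.aemeasurable,
          mul_assoc]
    _ ≤ 2 * ∫⁻ s in Ioi (0 : ℝ), ν (Ici s) * ∫⁻ x, ENNReal.ofReal x ∂ν := by
        gcongr 2 * ?_
        exact setLIntegral_mono' measurableSet_Ioi fun s hs =>
          h.lintegral_ofReal_sub_mul_le (le_of_lt hs)
    _ = _ := by
        rw [lintegral_mul_const _ (by simpa using measurable_measure_Ici_add ν 0), ← e, sq]

/-- A log-concave tail lies below an exponential touching it at the origin. -/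
lemma TailLogConcave.exists_le_exp {ν : Measure ℝ} [IsFiniteMeasure ν] (h : TailLogConcave ν)
    (hpos : ∃ y > 0, ν (Ici y) ≠ 0) :
    ∃ c, 0 ≤ c ∧ ∀ x, ν.real (Ici x) ≤ ν.real (Ici 0) * Real.exp (-c * x) := by
  have anti : ∀ {x y : ℝ}, x ≤ y → ν.real (Ici y) ≤ ν.real (Ici x) := fun hxy =>
    measureReal_mono (Ici_subset_Ici.2 hxy)
  have pos : ∀ {y}, ν (Ici y) ≠ 0 → 0 < ν.real (Ici y) := fun hy =>
    ENNReal.toReal_pos hy (measure_ne_top _ _)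
  obtain ⟨y₀, hy₀, hy₀'⟩ := hpos
  have hp : 0 < ν.real (Ici 0) := (pos hy₀').trans_le (anti hy₀.le)
  have slope : ∀ x < 0, ∀ y > 0, 0 < ν.real (Ici y) →
      (Real.log (ν.real (Ici x)) - Real.log (ν.real (Ici 0))) / (-x) ≤
        (Real.log (ν.real (Ici 0)) - Real.log (ν.real (Ici y))) / y := by
    intro x hx y hy hSy
    have hSx : 0 < ν.real (Ici x) := hp.trans_le (anti hx.le)
    have hd : 0 < y - x := by linarith
    have h1 := h (div_pos hy hd) (div_pos (neg_pos.2 hx) hd) (by field_simp; ring) x y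
    have e0 : y / (y - x) * x + -x / (y - x) * y = 0 := by field_simp; ring
    rw [e0] at h1
    have h2 := ENNReal.toReal_mono (measure_ne_top _ _) h1
    rw [ENNReal.toReal_mul, ← ENNReal.toReal_rpow, ← ENNReal.toReal_rpow] at h2
    change ν.real (Ici x) ^ _ * ν.real (Ici y) ^ _ ≤ ν.real (Ici 0) at h2
    have h3 := Real.log_le_log (by positivity) h2
    rw [Real.log_mul (by positivity) (by positivity), Real.log_rpow hSx, Real.log_rpow hSy] at h3
    rw [div_le_div_iff₀ (neg_pos.2 hx) hy]
    have h4 := mul_le_mul_of_nonneg_left h3 hd.le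
    have e1 : (y - x) * (y / (y - x) * Real.log (ν.real (Ici x)) +
        -x / (y - x) * Real.log (ν.real (Ici y))) =
        y * Real.log (ν.real (Ici x)) - x * Real.log (ν.real (Ici y)) := by
      field_simp; ring
    rw [e1] at h4
    nlinarith
  set α : ℝ → ℝ := fun x => (Real.log (ν.real (Ici x)) - Real.log (ν.real (Ici 0))) / (-x)
  have bdd : BddAbove (α '' Iio 0) := by
    refine ⟨(Real.log (ν.real (Ici 0)) - Real.log (ν.real (Ici y₀))) / y₀, ?_⟩
    rintro _ ⟨x, hx, rfl⟩
    exact slope x hx y₀ hy₀ (pos hy₀')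
  have le_c : ∀ x < 0, α x ≤ sSup (α '' Iio 0) := fun x hx => le_csSup bdd ⟨x, hx, rfl⟩
  refine ⟨sSup (α '' Iio 0), ?_, fun x => ?_⟩
  · refine le_trans ?_ (le_c (-1) (by norm_num))
    refine div_nonneg (sub_nonneg.2 (Real.log_le_log hp (anti (by norm_num)))) (by norm_num)
  · rcases (measureReal_nonneg (μ := ν) (s := Ici x)).eq_or_lt with h0 | h0
    · rw [← h0]; positivity
    rw [← Real.log_le_log_iff h0 (by positivity), Real.log_mul hp.ne' (Real.exp_ne_zero _),
      Real.log_exp]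
    rcases lt_trichotomy x 0 with hx | rfl | hx
    · have := le_c x hx
      rw [div_le_iff₀ (neg_pos.2 hx)] at this
      linarith
    · simp
    · have : sSup (α '' Iio 0) ≤ _ := csSup_le ⟨α (-1), -1, by norm_num, rfl⟩
        (by rintro _ ⟨z, hz, rfl⟩; exact slope z hz x hx h0)
      rw [le_div_iff₀ hx] at this
      linarith

/-- Grünbaum's inequality for a centred measure with log-concave tail. -/
lemma TailLogConcave.exp_neg_one_le {ν : Measure ℝ} [IsProbabilityMeasure ν]
    (h : TailLogConcave ν) (hpos : ∃ y > 0, ν (Ici y) ≠ 0) (hint : Integrable (fun x => x) ν)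
    (hmean : ∫ x, x ∂ν = 0) : Real.exp (-1) ≤ ν.real (Ici 0) := by
  obtain ⟨c, hc, hle⟩ := h.exists_le_exp hpos
  set p := ν.real (Ici 0) with hp
  have hp0 : 0 < p := by
    obtain ⟨y, hy, hy'⟩ := hpos
    exact (ENNReal.toReal_pos hy' (measure_ne_top _ _)).trans_le
      (measureReal_mono (Ici_subset_Ici.2 hy.le))
  rcases hc.eq_or_lt with rfl | hc
  · have T := (ENNReal.tendsto_toReal (measure_ne_top ν univ)).comp (tendsto_measure_Ici_atBot ν)
    have : (ν univ).toReal ≤ p := le_of_tendsto T (.of_forall fun x => by simpa using! hle x)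
    rw [measure_univ, ENNReal.toReal_one] at this
    exact (Real.exp_le_one_iff.2 (by norm_num)).trans this
  set x₀ := Real.log p / c with hx₀
  have h1 : ENNReal.ofReal (-x₀) ≤ ∫⁻ x, ENNReal.ofReal (x - x₀) ∂ν := by
    have hi : Integrable (fun x => x - x₀) ν := hint.sub (integrable_const _)
    have e : ∫ x, (x - x₀) ∂ν = -x₀ := by
      rw [integral_sub hint (integrable_const _), hmean]; simp
    have e' : ∫⁻ x, ENNReal.ofReal (x - x₀) ∂ν = ENNReal.ofReal (∫ x, max (x - x₀) 0 ∂ν) := by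
      rw [ofReal_integral_eq_lintegral_ofReal hi.pos_part (.of_forall fun x => le_max_right _ _)]
      simp
    rw [e', ← e]
    exact ENNReal.ofReal_le_ofReal (integral_mono hi hi.pos_part fun x => le_max_left _ _)
  have h2 : ∫⁻ x, ENNReal.ofReal (x - x₀) ∂ν ≤ ENNReal.ofReal (1 / c) := by
    rw [lintegral_ofReal_sub_eq]
    have hI : ∫ r in Ioi (0 : ℝ), Real.exp (-c * r) = 1 / c := by
      rw [integral_exp_mul_Ioi (neg_neg_of_pos hc)]; simp
    rw [← hI, ofReal_integral_eq_lintegral_ofReal (integrableOn_exp_mul_Ioi (neg_neg_of_pos hc) 0)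
      (.of_forall fun _ => (Real.exp_pos _).le)]
    refine lintegral_mono fun r => ?_
    rw [← ofReal_measureReal]
    refine ENNReal.ofReal_le_ofReal ((hle _).trans_eq ?_)
    have : -c * (x₀ + r) = -Real.log p + -c * r := by rw [hx₀]; field_simp; ring
    rw [this, Real.exp_add, Real.exp_neg, Real.exp_log hp0, mul_inv_cancel_left₀ hp0.ne']
  have h3 := (ENNReal.ofReal_le_ofReal_iff (by positivity)).1 (h1.trans h2)
  rw [← Real.le_log_iff_exp_le hp0]
  rw [hx₀, ← neg_div, div_le_div_iff_of_pos_right hc] at h3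
  linarith

lemma exists_measure_Ici_ne_zero {ν : Measure ℝ} [IsProbabilityMeasure ν] (h0 : ν {0} = 0)
    (hint : Integrable (fun x => x) ν) (hmean : ∫ x, x ∂ν = 0) : ∃ y > 0, ν (Ici y) ≠ 0 := by
  by_contra! H
  have e := lintegral_ofReal_sub_eq ν 0
  simp only [sub_zero, zero_add] at e
  rw [setLIntegral_congr_fun measurableSet_Ioi (fun r hr => H r hr), lintegral_zero,
    lintegral_eq_zero_iff (by fun_prop)] at e
  have hn : 0 ≤ᵐ[ν] fun x => -x := e.mono fun x hx => by simpa using! hx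
  have h1 : ∫ x, -x ∂ν = 0 := by rw [integral_neg, hmean, neg_zero]
  rw [integral_eq_zero_iff_of_nonneg_ae hn hint.neg] at h1
  have h2 : ∀ᵐ x ∂ν, x ≠ 0 := by
    rw [ae_iff]; simpa using h0
  obtain ⟨x, hx, hx'⟩ := (h1.and h2).exists
  exact hx' (by simpa using hx)

/-- Lower tail bound for isotropic measures on the line with log-concave tails. -/
lemma exp_neg_one_sub_le_measure_Ici {ν : Measure ℝ} [IsProbabilityMeasure ν]
    (h : TailLogConcave ν) (h' : TailLogConcave (ν.map Neg.neg)) (h0 : ν {0} = 0)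
    (hint : Integrable (fun x => x) ν) (hint2 : Integrable (fun x => x ^ 2) ν)
    (hmean : ∫ x, x ∂ν = 0) (hvar : ∫ x, x ^ 2 ∂ν = 1) {t : ℝ} (ht : 0 ≤ t) :
    Real.exp (-1) - t ≤ ν.real (Ici t) := by
  have mneg : Measurable (Neg.neg : ℝ → ℝ) := measurable_neg
  have : IsProbabilityMeasure (ν.map Neg.neg) := Measure.isProbabilityMeasure_map mneg.aemeasurable
  have hint' : Integrable (fun x => x) (ν.map Neg.neg) := by
    rw [integrable_map_measure (by fun_prop) mneg.aemeasurable]; exact hint.neg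
  have hmean' : ∫ x, x ∂(ν.map Neg.neg) = 0 := by
    rw [integral_map mneg.aemeasurable (by fun_prop), integral_neg, hmean, neg_zero]
  have h0' : (ν.map Neg.neg) {0} = 0 := by
    rw [Measure.map_apply mneg (measurableSet_singleton 0)]; simpa using h0
  have hp := h.exp_neg_one_le (exists_measure_Ici_ne_zero h0 hint hmean) hint hmean
  have hq := h'.exp_neg_one_le (exists_measure_Ici_ne_zero h0' hint' hmean') hint' hmean'
  have hpq : ν.real (Ici 0) + (ν.map Neg.neg).real (Ici 0) = 1 := by
    have e : (ν.map Neg.neg).real (Ici 0) = ν.real (Iio 0) := by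
      rw [map_measureReal_apply mneg measurableSet_Ici]
      refine measureReal_congr ?_
      have : (Neg.neg ⁻¹' Ici 0 : Set ℝ) = Iic 0 := by ext x; simp
      rw [this]
      exact (Iio_ae_eq_Iic' h0).symm
    rw [e, ← compl_Ici, probReal_add_probReal_compl measurableSet_Ici]
  have A := h.lintegral_sq_mul_le
  have B := h'.lintegral_sq_mul_le
  have P := h.lintegral_ofReal_sub_mul_le ht
  rw [lintegral_map (by fun_prop) mneg, lintegral_map (by fun_prop) mneg] at B
  have Mfin : ∫⁻ x, ENNReal.ofReal x ∂ν ≠ ∞ := hint.lintegral_lt_top.ne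
  have Meq : ∫⁻ x, ENNReal.ofReal (-x) ∂ν = ∫⁻ x, ENNReal.ofReal x ∂ν := by
    have := integral_eq_lintegral_pos_part_sub_lintegral_neg_part hint
    rw [hmean, eq_comm, sub_eq_zero] at this
    exact ((ENNReal.toReal_eq_toReal_iff' Mfin hint.neg.lintegral_lt_top.ne).1 this).symm
  have AB : ∫⁻ x, ENNReal.ofReal x ^ 2 ∂ν + ∫⁻ x, ENNReal.ofReal (-x) ^ 2 ∂ν = 1 := by
    rw [← lintegral_add_left (by fun_prop), ← ENNReal.ofReal_one, ← hvar,
      ofReal_integral_eq_lintegral_ofReal hint2 (.of_forall fun x => sq_nonneg x)]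
    refine lintegral_congr fun x => ?_
    rcases le_total 0 x with hx | hx
    · rw [ENNReal.ofReal_of_nonpos (neg_nonpos.2 hx), ENNReal.ofReal_pow hx]; simp
    · rw [ENNReal.ofReal_of_nonpos hx, ← ENNReal.ofReal_pow (neg_nonneg.2 hx)]; simp
  have Tle : ∫⁻ x, ENNReal.ofReal x ∂ν ≤
      ENNReal.ofReal t * ν (Ici 0) + ∫⁻ x, ENNReal.ofReal (x - t) ∂ν := by
    rw [← lintegral_indicator_const measurableSet_Ici,
      ← lintegral_add_left (measurable_const.indicator measurableSet_Ici)]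
    refine lintegral_mono fun x => ?_
    rcases le_or_gt 0 x with hx | hx
    · simp only [indicator_of_mem (mem_Ici.2 hx)]
      refine le_trans (le_of_eq ?_) ENNReal.ofReal_add_le
      congr 1; ring
    · simp [ENNReal.ofReal_of_nonpos hx.le]
  rw [Meq] at B
  have Tfin : ∫⁻ x, ENNReal.ofReal (x - t) ∂ν ≠ ∞ :=
    (hint.sub (integrable_const t)).lintegral_lt_top.ne
  have Afin : ∫⁻ x, ENNReal.ofReal x ^ 2 ∂ν ≠ ∞ := fun H => by simp [H] at AB
  have Bfin : ∫⁻ x, ENNReal.ofReal (-x) ^ 2 ∂ν ≠ ∞ := fun H => by simp [H] at AB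
  have Ar := ENNReal.toReal_mono (by finiteness) A
  have Br := ENNReal.toReal_mono (by finiteness) B
  have Pr := ENNReal.toReal_mono (by finiteness) P
  have Tr := ENNReal.toReal_mono (by finiteness) Tle
  have ABr := congrArg ENNReal.toReal AB
  rw [ENNReal.toReal_add (by finiteness) (by finiteness)] at Tr
  rw [ENNReal.toReal_add Afin Bfin] at ABr
  simp only [ENNReal.toReal_mul, ENNReal.toReal_pow, ENNReal.toReal_ofNat, ENNReal.toReal_one,
    ENNReal.toReal_ofReal ht, ← measureReal_def] at Ar Br Pr Tr ABr
  have hM0 := ENNReal.toReal_nonneg (a := ∫⁻ x, ENNReal.ofReal x ∂ν)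
  have hS0 := measureReal_nonneg (μ := ν) (s := Ici t)
  have hS00 : t = 0 → ν.real (Ici t) = ν.real (Ici 0) := fun h => by rw [h]
  generalize (∫⁻ x, ENNReal.ofReal x ∂ν).toReal = M at *
  generalize (∫⁻ x, ENNReal.ofReal (x - t) ∂ν).toReal = T at *
  generalize (∫⁻ x, ENNReal.ofReal x ^ 2 ∂ν).toReal = a at *
  generalize (∫⁻ x, ENNReal.ofReal (-x) ^ 2 ∂ν).toReal = b at *
  generalize ν.real (Ici 0) = p at *
  generalize (ν.map Neg.neg).real (Ici 0) = q at *
  generalize ν.real (Ici t) = S at *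
  have hk0 : 0 < Real.exp (-1) := Real.exp_pos _
  generalize Real.exp (-1) = k at *
  by_contra! hS
  rcases ht.eq_or_lt with rfl | ht
  · linarith [hS00 rfl]
  have hp0 : 0 < p := hk0.trans_le hp
  have hq0 : 0 < q := hk0.trans_le hq
  have hMp : M ≤ k * p := by
    have h1 : M * (p - k + t) ≤ t * p ^ 2 := by nlinarith
    have h2 : t * p ≤ k * (p - k + t) := by nlinarith
    have h3 : M * (t * p) ≤ k * (t * p ^ 2) := by nlinarith
    have : (t * p) * M ≤ (t * p) * (k * p) := by nlinarith
    exact le_of_mul_le_mul_left this (by positivity)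
  have h1 : p * q ≤ 2 * M ^ 2 := by
    have : p * q * (a + b) ≤ 2 * M ^ 2 * (q + p) := by nlinarith
    rw [ABr, add_comm q p, hpq] at this
    linarith
  have h2 : p * q ≤ p * (2 * k ^ 2 * p) := by nlinarith
  have h3 := le_of_mul_le_mul_left h2 hp0
  have h4 : k * (1 + 2 * k ^ 2) ≤ 2 * k ^ 2 := by nlinarith
  nlinarith [sq_nonneg (k - 1 / 2)]

section Marginal

variable {d : ℕ} {K : Set (EuclideanSpace ℝ (Fin d))}

lemma uniform_map_apply (z u : EuclideanSpace ℝ (Fin d)) {B : Set ℝ} (hB : MeasurableSet B) :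
    (((volume.restrict K univ)⁻¹ • volume.restrict K).map fun x => ⟪u, x - z⟫) B =
      (volume K)⁻¹ * volume (K ∩ {x | ⟪u, x - z⟫ ∈ B}) := by
  have hm : Measurable fun x : EuclideanSpace ℝ (Fin d) => ⟪u, x - z⟫ := by fun_prop
  rw [Measure.map_apply hm hB, Measure.smul_apply, Measure.restrict_apply (hm hB),
    Measure.restrict_apply_univ, smul_eq_mul, inter_comm]
  rfl

/-- One-dimensional marginals of the uniform measure on a convex body have log-concave tails. -/
lemma tailLogConcave_uniform_map (hconv : Convex ℝ K) (hK : IsCompact K) (hvol : volume K ≠ 0)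
    (z u : EuclideanSpace ℝ (Fin d)) :
    TailLogConcave (((volume.restrict K univ)⁻¹ • volume.restrict K).map fun x => ⟪u, x - z⟫) := by
  intro l m hl hm hlm s r
  have meas : ∀ s : ℝ, MeasurableSet (K ∩ {x | ⟪u, x - z⟫ ∈ Ici s}) := fun s =>
    hK.measurableSet.inter
      ((show Measurable fun x : EuclideanSpace ℝ (Fin d) => ⟪u, x - z⟫ by fun_prop) measurableSet_Ici)
  simp only [uniform_map_apply z u measurableSet_Ici]
  have bm := volume_rpow_mul_volume_rpow_le hl hm hlm (meas s) (meas r) (meas (l * s + m * r)) <| by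
    rintro x ⟨hx, hx'⟩ y ⟨hy, hy'⟩
    refine ⟨hconv hx hy hl.le hm.le hlm, ?_⟩
    have e : l • x + m • y - z = l • (x - z) + m • (y - z) := by
      have : z = l • z + m • z := by rw [← add_smul, hlm, one_smul]
      nth_rewrite 1 [this]
      module
    simp only [mem_ofPred_eq, mem_Ici] at hx' hy' ⊢
    rw [e, inner_add_right, inner_smul_right, inner_smul_right]
    gcongr
  have hV0 : (volume K)⁻¹ ≠ 0 := ENNReal.inv_ne_zero.2 hK.measure_lt_top.ne
  have hVt : (volume K)⁻¹ ≠ ∞ := ENNReal.inv_ne_top.2 hvol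
  rw [ENNReal.mul_rpow_of_nonneg _ _ hl.le, ENNReal.mul_rpow_of_nonneg _ _ hm.le,
    mul_mul_mul_comm, ← ENNReal.rpow_add _ _ hV0 hVt, hlm, ENNReal.rpow_one]
  gcongr

lemma volume_inner_sub_eq_zero {u : EuclideanSpace ℝ (Fin d)} (hu : u ≠ 0)
    (z : EuclideanSpace ℝ (Fin d)) : volume {x | ⟪u, x - z⟫ = 0} = 0 := by
  have hne : (ℝ ∙ u)ᗮ ≠ ⊤ := by
    intro h
    have : u ∈ (ℝ ∙ u)ᗮ := h ▸ Submodule.mem_top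
    rw [Submodule.mem_orthogonal_singleton_iff_inner_right, inner_self_eq_zero] at this
    exact hu this
  have e : {x | ⟪u, x - z⟫ = 0} =
      (fun x => x - z) ⁻¹' ((ℝ ∙ u)ᗮ : Set (EuclideanSpace ℝ (Fin d))) := by
    ext x
    simp [Submodule.mem_orthogonal_singleton_iff_inner_right]
  rw [e, (measurePreserving_sub_right volume z).measure_preimage_emb
    (MeasurableEquiv.subRight z).measurableEmbedding, Measure.addHaar_submodule _ _ hne]

end Marginal

end Auxiliary

/-- Grünbaum-type bound: if `z` is the centroid of a convex body `K ⊆ ℝ^d` in isotropic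
position and `H` is a halfspace whose bounding hyperplane is within distance `t` of `z`,
then `vol(K ∩ H) ≥ (1/e - t) · vol(K)`. -/
theorem gruenbaum_cut (d : ℕ) (hd : 1 ≤ d) (K : Set (EuclideanSpace ℝ (Fin d)))
    (hconv : Convex ℝ K) (hcomp : IsCompact K) (hvol : volume K ≠ 0)
    (z : EuclideanSpace ℝ (Fin d)) (hcent : (⨍ x in K, x) = z)
    (hcov : ∀ u v : EuclideanSpace ℝ (Fin d),
      ⨍ x in K, (⟪x - z, u⟫ * ⟪x - z, v⟫) = ⟪u, v⟫)
    (a : EuclideanSpace ℝ (Fin d)) (b t : ℝ) (ha : ‖a‖ = 1) (ht : 0 ≤ t)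
    (hdist : |⟪a, z⟫ - b| ≤ t) :
    ENNReal.ofReal (1 / Real.exp 1 - t) * volume K ≤
      volume (K ∩ {x | b ≤ ⟪a, x⟫}) := by
  set μ : Measure (EuclideanSpace ℝ (Fin d)) := (volume.restrict K Set.univ)⁻¹ • volume.restrict K
    with hμ
  have hVt : volume K ≠ ⊤ := hcomp.measure_lt_top.ne
  have hμp : IsProbabilityMeasure μ := ⟨by
    rw [hμ, Measure.smul_apply, Measure.restrict_apply_univ, smul_eq_mul,
      ENNReal.inv_mul_cancel hvol hVt]⟩
  have hφ : Measurable fun x : EuclideanSpace ℝ (Fin d) => ⟪a, x - z⟫ := by fun_prop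
  have integrable_of_continuous : ∀ {F : Type} [NormedAddCommGroup F]
      {f : EuclideanSpace ℝ (Fin d) → F}, Continuous f → Integrable f μ := fun hf =>
    Integrable.smul_measure (hf.continuousOn.integrableOn_compact hcomp)
      (ENNReal.inv_ne_top.2 (by rwa [Measure.restrict_apply_univ]))
  set ν := μ.map fun x => ⟪a, x - z⟫ with hν
  have hνp : IsProbabilityMeasure ν := Measure.isProbabilityMeasure_map hφ.aemeasurable
  have hneg : ν.map Neg.neg = μ.map fun x => ⟪-a, x - z⟫ := by
    rw [hν, Measure.map_map measurable_neg hφ]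
    congr 1
    ext x
    simp [inner_neg_left]
  have ha0 : a ≠ 0 := by rintro rfl; simp at ha
  have hzero : ν {0} = 0 := by
    rw [hν, hμ, uniform_map_apply z a (measurableSet_singleton 0),
      mul_eq_zero]
    exact Or.inr (measure_mono_null (fun x hx => hx.2) (volume_inner_sub_eq_zero ha0 z))
  have hmean : ∫ x, x ∂ν = 0 := by
    rw [hν, integral_map hφ.aemeasurable (by fun_prop)]
    have hi : Integrable (fun x => x - z) μ := integrable_of_continuous (by fun_prop)
    rw [integral_inner hi, integral_sub (integrable_of_continuous (by fun_prop)) (integrable_const _)]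
    have : ∫ x, x ∂μ = z := hcent
    simp [this]
  have hvar : ∫ x, x ^ 2 ∂ν = 1 := by
    rw [hν, integral_map hφ.aemeasurable (by fun_prop)]
    have : ∫ x, ⟪x - z, a⟫ * ⟪x - z, a⟫ ∂μ = ⟪a, a⟫ := hcov a a
    rw [real_inner_self_eq_norm_sq, ha, one_pow] at this
    simpa only [sq, real_inner_comm] using this
  have key : ∀ s, 0 ≤ s → Real.exp (-1) - s ≤ ν.real (Set.Ici s) := fun s hs =>
    exp_neg_one_sub_le_measure_Ici (tailLogConcave_uniform_map hconv hcomp hvol z a)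
      (hneg ▸ tailLogConcave_uniform_map hconv hcomp hvol z (-a)) hzero
      ((integrable_map_measure (by fun_prop) hφ.aemeasurable).2
        (integrable_of_continuous (by fun_prop)))
      ((integrable_map_measure (by fun_prop) hφ.aemeasurable).2
        (integrable_of_continuous (by fun_prop))) hmean hvar hs
  have hbound : Real.exp (-1) - t ≤ ν.real (Set.Ici (b - ⟪a, z⟫)) := by
    have h1 : b - ⟪a, z⟫ ≤ t := by linarith [neg_le_of_abs_le hdist]
    calc Real.exp (-1) - t ≤ Real.exp (-1) - max (b - ⟪a, z⟫) 0 :=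
          sub_le_sub_left (max_le h1 ht) _
      _ ≤ ν.real (Set.Ici (max (b - ⟪a, z⟫) 0)) := key _ (le_max_right _ _)
      _ ≤ _ := measureReal_mono (Set.Ici_subset_Ici.2 (le_max_left _ _))
  have hset : {x | ⟪a, x - z⟫ ∈ Set.Ici (b - ⟪a, z⟫)} = {x | b ≤ ⟪a, x⟫} := by
    ext x
    simp [inner_sub_right]
  have h2 := ENNReal.ofReal_le_ofReal hbound
  rw [ofReal_measureReal, hν, hμ, uniform_map_apply z a measurableSet_Ici, hset, Real.exp_neg,
    inv_eq_one_div] at h2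
  calc _ ≤ ((volume K)⁻¹ * volume (K ∩ {x | b ≤ ⟪a, x⟫})) * volume K := by gcongr
    _ = volume (K ∩ {x | b ≤ ⟪a, x⟫}) := by
      rw [mul_comm, ← mul_assoc, ENNReal.mul_inv_cancel hvol hVt, one_mul]
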